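/- arXiv:1808.10165 — 3 statements merged into one kernel-verified Lean document; each statement's English description precedes it below -/
import Mathlib

section
/- Let $n\ge 0$ and $l\ge 0$ be integers and let $f\in\mathbb{C}[u,v]$ be a nonzero homogeneous polynomial of degree $l$ which is $n$-equivariant, i.e. $f(u\cos\theta-v\sin\theta,\,u\sin\theta+v\cos\theta)=e^{-in\theta}f(u,v)$ for all $\theta\in\mathbb{R}$ and all $u,v\in\mathbb{C}$. Then $l-n$ is a nonnegative even integer, say $l=n+2m$ with $m\in\mathbb{N}\cup\{0\}$, and $f(u,v)=f(1,0)\,(u^2+v^2)^{m}(u-iv)^{n}$ for all $u,v\in\mathbb{C}$. -/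
open MvPolynomial

/-- `f` is `n`-equivariant for the rotation action:
`f(u cos θ - v sin θ, u sin θ + v cos θ) = e^{-inθ} f(u,v)`. -/
def NEquivariant (n : ℤ) (f : MvPolynomial (Fin 2) ℂ) : Prop :=
  ∀ (θ : ℝ) (u v : ℂ),
    eval ![u * (Real.cos θ : ℂ) - v * (Real.sin θ : ℂ),
          u * (Real.sin θ : ℂ) + v * (Real.cos θ : ℂ)] f
      = Complex.exp (-(n : ℂ) * Complex.I * (θ : ℂ)) * eval ![u, v] f

lemma infinite_range_exp_mul_I :
    (Set.range fun θ : ℝ => Complex.exp ((θ : ℂ) * Complex.I)).Infinite := by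
  refine Set.Infinite.of_image Complex.re
    ((Set.Icc_infinite (show (-1 : ℝ) < 1 by norm_num)).mono ?_)
  rintro x ⟨h₁, h₂⟩
  exact ⟨_, ⟨Real.arccos x, rfl⟩, by rw [Complex.exp_ofReal_mul_I_re, Real.cos_arccos h₁ h₂]⟩

lemma eval_smul_pair {l : ℕ} {f : MvPolynomial (Fin 2) ℂ} (hf : f.IsHomogeneous l)
    (t a b : ℂ) : eval ![t * a, t * b] f = t ^ l * eval ![a, b] f := by
  rw [eval_eq', eval_eq', Finset.mul_sum]
  refine Finset.sum_congr rfl fun d hd => ?_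
  have h : d 0 + d 1 = l := by
    have := hf (mem_support_iff.mp hd)
    simpa [Finsupp.weight_apply, Finsupp.sum_fintype] using this
  simp only [Fin.prod_univ_two, Matrix.cons_val_zero, Matrix.cons_val_one, mul_pow, ← h, pow_add]
  ring

/-- Two polynomials that agree off the isotropic lines `u² + v² = 0` are equal. -/
lemma eq_of_eval_eq_off_isotropic {f g : MvPolynomial (Fin 2) ℂ}
    (h : ∀ u v : ℂ, u ^ 2 + v ^ 2 ≠ 0 → eval ![u, v] f = eval ![u, v] g) : f = g := by
  have hq : (X 0 ^ 2 + X 1 ^ 2 : MvPolynomial (Fin 2) ℂ) ≠ 0 := fun h0 => by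
    simpa using congrArg (eval ![(1 : ℂ), 0]) h0
  refine mul_left_cancel₀ hq (MvPolynomial.funext fun x => ?_)
  obtain ⟨u, v, rfl⟩ : ∃ u v, x = ![u, v] := ⟨x 0, x 1, by ext i; fin_cases i <;> rfl⟩
  by_cases h0 : u ^ 2 + v ^ 2 = 0
  · simp [h0]
  · simp [h u v h0]

/-- The restriction of `f` to the line `u - iv = 1`, parametrized by `u + iv`. -/
noncomputable def restrictLine (f : MvPolynomial (Fin 2) ℂ) : Polynomial ℂ :=
  aeval ![Polynomial.C (1 / 2) * (Polynomial.X + 1),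
    Polynomial.C (-Complex.I / 2) * (Polynomial.X - 1)] f

lemma eval_restrictLine (f : MvPolynomial (Fin 2) ℂ) (z : ℂ) :
    (restrictLine f).eval z = eval ![1 / 2 * (z + 1), -Complex.I / 2 * (z - 1)] f := by
  rw [restrictLine, ← Polynomial.coe_aeval_eq_eval, ← AlgHom.comp_apply, comp_aeval,
    ← coe_aeval_eq_eval]
  change aeval _ f = aeval _ f
  congr 2
  ext i
  fin_cases i <;> simp

lemma eval_eq_pow_mul_eval_restrictLine {l : ℕ} {f : MvPolynomial (Fin 2) ℂ}
    (hf : f.IsHomogeneous l) {u v : ℂ} (hw : u - Complex.I * v ≠ 0) :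
    eval ![u, v] f = (u - Complex.I * v) ^ l *
      (restrictLine f).eval ((u + Complex.I * v) / (u - Complex.I * v)) := by
  have hz : (u - Complex.I * v) * ((u + Complex.I * v) / (u - Complex.I * v) - 1)
      = 2 * Complex.I * v := by
    field_simp
    ring
  rw [eval_restrictLine, ← eval_smul_pair hf]
  congr 2
  ext i
  fin_cases i
  · simp only [Fin.zero_eta, Matrix.cons_val_zero]
    linear_combination -1 / 2 * hz
  · simp only [Fin.mk_one, Matrix.cons_val_one, Matrix.cons_val_fin_one]
    linear_combination Complex.I / 2 * hz + v * Complex.I_sq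

lemma X_pow_mul_expand_restrictLine {n l : ℕ} {f : MvPolynomial (Fin 2) ℂ}
    (hhom : f.IsHomogeneous l) (hequiv : NEquivariant (n : ℤ) f) :
    Polynomial.X ^ n * Polynomial.expand ℂ 2 (restrictLine f)
      = Polynomial.C (eval ![(1 : ℂ), 0] f) * Polynomial.X ^ l := by
  refine Polynomial.eq_of_infinite_eval_eq _ _ (infinite_range_exp_mul_I.mono ?_)
  rintro _ ⟨θ, rfl⟩
  have h := hequiv θ 1 0
  simp only [one_mul, zero_mul, sub_zero, add_zero] at h
  have hexp : Complex.exp (-((n : ℤ) : ℂ) * Complex.I * θ)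
      * Complex.exp (θ * Complex.I) ^ n = 1 := by
    rw [← Complex.exp_nat_mul, ← Complex.exp_add, Complex.exp_eq_one_iff]
    exact ⟨0, by push_cast; ring⟩
  have hcs : (Real.cos θ : ℂ) ^ 2 + (Real.sin θ : ℂ) ^ 2 = 1 := by
    rw [add_comm]; exact_mod_cast Real.sin_sq_add_cos_sq θ
  have ht : Complex.exp (θ * Complex.I) = Real.cos θ + Real.sin θ * Complex.I := by
    rw [Complex.exp_mul_I]; simp
  have hline : (restrictLine f).eval (Complex.exp (θ * Complex.I) ^ 2)
      = Complex.exp (θ * Complex.I) ^ l * eval ![(Real.cos θ : ℂ), (Real.sin θ : ℂ)] f := by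
    rw [eval_restrictLine, ← eval_smul_pair hhom, ht]
    generalize (Real.cos θ : ℂ) = c at *
    generalize (Real.sin θ : ℂ) = s at *
    congr 2
    ext i
    fin_cases i
    · simp only [Fin.zero_eta, Matrix.cons_val_zero]
      linear_combination (1 / 2 * s ^ 2) * Complex.I_sq - 1 / 2 * hcs
    · simp only [Fin.mk_one, Matrix.cons_val_one, Matrix.cons_val_fin_one]
      linear_combination (-c * s - Complex.I / 2 * s ^ 2) * Complex.I_sq - Complex.I / 2 * hcs
  simp only [Set.mem_ofPred_eq, Polynomial.eval_mul, Polynomial.eval_pow, Polynomial.eval_X,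
    Polynomial.eval_C, Polynomial.expand_eval, hline, h]
  linear_combination (Complex.exp (θ * Complex.I) ^ l * eval ![(1 : ℂ), 0] f) * hexp

/-- Necessity direction of Proposition 2.3: a nonzero homogeneous `n`-equivariant
polynomial of degree `l` satisfies `l = n + 2m` and equals
`f(1,0) (u²+v²)^m (u-iv)^n`. -/
theorem stmt3 (n l : ℕ) (f : MvPolynomial (Fin 2) ℂ) (hf : f ≠ 0)
    (hhom : f.IsHomogeneous l) (hequiv : NEquivariant (n : ℤ) f) :
    ∃ m : ℕ, l = n + 2 * m ∧
      ∀ u v : ℂ, eval ![u, v] f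
        = eval ![(1 : ℂ), 0] f * (u ^ 2 + v ^ 2) ^ m * (u - Complex.I * v) ^ n := by
  have key := X_pow_mul_expand_restrictLine hhom hequiv
  have hfac (u v : ℂ) : u ^ 2 + v ^ 2 = (u + Complex.I * v) * (u - Complex.I * v) := by
    linear_combination v ^ 2 * Complex.I_sq
  have hp : restrictLine f ≠ 0 := fun hp0 => hf <| eq_of_eval_eq_off_isotropic fun u v huv => by
    rw [hfac] at huv
    rw [eval_eq_pow_mul_eval_restrictLine hhom (right_ne_zero_of_mul huv), hp0]
    simp
  have hexpand : Polynomial.expand ℂ 2 (restrictLine f) ≠ 0 :=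
    (Polynomial.expand_ne_zero two_pos).2 hp
  have hc : eval ![(1 : ℂ), 0] f ≠ 0 := fun hc0 => by
    rw [hc0, Polynomial.C_0, zero_mul] at key
    exact mul_ne_zero (pow_ne_zero n Polynomial.X_ne_zero) hexpand key
  have hl : l = n + 2 * (restrictLine f).natDegree := by
    have := congrArg Polynomial.natDegree key
    rw [Polynomial.natDegree_C_mul_X_pow _ _ hc,
      Polynomial.natDegree_mul (pow_ne_zero n Polynomial.X_ne_zero) hexpand,
      Polynomial.natDegree_X_pow, Polynomial.natDegree_expand] at this
    lia
  generalize (restrictLine f).natDegree = m at hl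
  refine ⟨m, hl, fun a b => ?_⟩
  have hline (z : ℂ) : (restrictLine f).eval z = eval ![(1 : ℂ), 0] f * z ^ m := by
    have : restrictLine f = Polynomial.C (eval ![(1 : ℂ), 0] f) * Polynomial.X ^ m := by
      refine Polynomial.expand_injective two_pos
        (mul_left_cancel₀ (pow_ne_zero n Polynomial.X_ne_zero) (key.trans ?_))
      rw [map_mul, Polynomial.expand_C, map_pow, Polynomial.expand_X, hl]
      ring
    rw [this]
    simp
  have hfg : f = C (eval ![(1 : ℂ), 0] f) * (X 0 ^ 2 + X 1 ^ 2) ^ m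
      * (X 0 - C Complex.I * X 1) ^ n := by
    refine eq_of_eval_eq_off_isotropic fun u v huv => ?_
    rw [hfac] at huv
    have hw := right_ne_zero_of_mul huv
    rw [eval_eq_pow_mul_eval_restrictLine hhom hw, hline, hl]
    simp only [map_mul, map_pow, map_add, map_sub, eval_C, eval_X, Matrix.cons_val_zero,
      Matrix.cons_val_one, Matrix.cons_val_fin_one, hfac, mul_pow, div_pow]
    field_simp
    ring
  simpa using congrArg (eval ![a, b]) hfg
end

section
/- Every $g\in SL(2,\mathbb{C})$ can be written as $g=k\,\begin{pmatrix}e^t&0\\0&e^{-t}\end{pmatrix}\,h$ where $k\in SU(2)$, $t\ge 0$, and $h$ is a complex $2\times 2$ matrix with $h^{T}h=I$ and $\det h=1$ (i.e. $h\in SO(2,\mathbb{C})$). Moreover the parameter $t\ge 0$ is uniquely determined by $g$. -/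
open Matrix

/-- `k` belongs to `SU(2)`. -/
def MemSU2 (k : Matrix (Fin 2) (Fin 2) ℂ) : Prop := kᴴ * k = 1 ∧ k.det = 1

/-- `h` belongs to `SO(2,ℂ)`. -/
def MemSO2C (h : Matrix (Fin 2) (Fin 2) ℂ) : Prop := hᵀ * h = 1 ∧ h.det = 1

/-- Polar coordinates, circular and hyperbolic, on the hyperboloid `p * q - x ^ 2 - y ^ 2 = 1`. -/
theorem exists_hyperboloid_coordinates {p q x y : ℝ} (hpq : 0 ≤ p + q)
    (hdet : p * q - x ^ 2 - y ^ 2 = 1) :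
    ∃ t η θ : ℝ, 0 ≤ t ∧ (p + q) / 2 = Real.cosh (2 * t) * Real.cosh (2 * η) ∧
      y = Real.cosh (2 * t) * Real.sinh (2 * η) ∧
      (p - q) / 2 = Real.sinh (2 * t) * Real.cos (2 * θ) ∧
      x = Real.sinh (2 * t) * Real.sin (2 * θ) := by
  set w : ℂ := ⟨(p - q) / 2, x⟩ with hw
  have hnorm : ‖w‖ ^ 2 = ((p - q) / 2) ^ 2 + x ^ 2 := by
    rw [Complex.sq_norm, Complex.normSq_apply]
    ring
  have hpos : 0 < Real.cosh (Real.arsinh ‖w‖) := Real.cosh_pos _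
  have hcosh : Real.cosh (Real.arsinh ‖w‖) ^ 2 = 1 + ‖w‖ ^ 2 := by
    rw [Real.cosh_sq, Real.sinh_arsinh, add_comm]
  refine ⟨Real.arsinh ‖w‖ / 2, Real.arsinh (y / Real.cosh (Real.arsinh ‖w‖)) / 2,
    w.arg / 2, ?_, ?_, ?_, ?_, ?_⟩
  · have := Real.arsinh_nonneg_iff.2 (norm_nonneg w)
    positivity
  · rw [mul_div_cancel₀ _ two_ne_zero, mul_div_cancel₀ _ two_ne_zero]
    refine (sq_eq_sq₀ (by positivity) (by positivity)).1 ?_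
    rw [mul_pow, Real.cosh_sq (Real.arsinh (y / _)), Real.sinh_arsinh, mul_add, ← mul_pow,
      mul_div_cancel₀ _ hpos.ne', hcosh, hnorm]
    linarith
  · rw [mul_div_cancel₀ _ two_ne_zero, mul_div_cancel₀ _ two_ne_zero, Real.sinh_arsinh,
      mul_div_cancel₀ _ hpos.ne']
  · rw [mul_div_cancel₀ _ two_ne_zero, mul_div_cancel₀ _ two_ne_zero, Real.sinh_arsinh,
      Complex.norm_mul_cos_arg]
  · rw [mul_div_cancel₀ _ two_ne_zero, mul_div_cancel₀ _ two_ne_zero, Real.sinh_arsinh,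
      Complex.norm_mul_sin_arg]

/-- The matrix `exp (diag (t, -t))`. -/
noncomputable def expDiag (t : ℝ) : Matrix (Fin 2) (Fin 2) ℂ :=
  !![(Real.exp t : ℂ), 0; 0, (Real.exp (-t) : ℂ)]

theorem expDiag_mul (s t : ℝ) : expDiag s * expDiag t = expDiag (s + t) := by
  ext i j
  fin_cases i <;> fin_cases j <;> simp [expDiag, Complex.exp_add, mul_comm]

theorem expDiag_zero : expDiag 0 = 1 := by
  ext i j
  fin_cases i <;> fin_cases j <;> simp [expDiag]

theorem det_expDiag (t : ℝ) : (expDiag t).det = 1 := by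
  simp [expDiag, det_fin_two, ← Complex.exp_add]

theorem conjTranspose_expDiag (t : ℝ) : (expDiag t)ᴴ = expDiag t := by
  ext i j
  fin_cases i <;> fin_cases j <;> simp [expDiag, -Complex.ofReal_exp]

theorem transpose_expDiag (t : ℝ) : (expDiag t)ᵀ = expDiag t := by
  ext i j
  fin_cases i <;> fin_cases j <;> simp [expDiag]

theorem trace_expDiag (t : ℝ) : (expDiag t).trace = ((2 * Real.cosh t : ℝ) : ℂ) := by
  simp [expDiag, trace_fin_two, Complex.cosh]
  ring

/-- The product of the rotation with entries `a, b` and the boost with entries `C, S`. -/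
noncomputable def rotationBoost (a b C S : ℝ) : Matrix (Fin 2) (Fin 2) ℂ :=
  !![(⟨a * C, -(b * S)⟩ : ℂ), ⟨b * C, a * S⟩; ⟨-(b * C), -(a * S)⟩, ⟨a * C, -(b * S)⟩]

theorem memSO2C_rotationBoost {a b C S : ℝ} (hab : a ^ 2 + b ^ 2 = 1) (hCS : C ^ 2 - S ^ 2 = 1) :
    MemSO2C (rotationBoost a b C S) := by
  have h : (a * C) ^ 2 - (b * S) ^ 2 + ((b * C) ^ 2 - (a * S) ^ 2) = 1 := by
    linear_combination (C ^ 2 - S ^ 2) * hab + hCS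
  refine ⟨?_, ?_⟩
  · ext i j
    fin_cases i <;> fin_cases j <;> apply Complex.ext <;>
      simp [rotationBoost, mul_apply, Fin.sum_univ_two] <;> linarith
  · rw [rotationBoost, det_fin_two_of]
    apply Complex.ext <;> simp <;> linarith

theorem conjTranspose_rotationBoost_mul_diagonal_mul {a b C S : ℝ} (e f : ℝ)
    (hab : a ^ 2 + b ^ 2 = 1) (hCS : C ^ 2 - S ^ 2 = 1) :
    (rotationBoost a b C S)ᴴ * !![(e : ℂ), 0; 0, (f : ℂ)] * rotationBoost a b C S =
      !![(((e + f) / 2 * (C ^ 2 + S ^ 2) + (e - f) / 2 * (a ^ 2 - b ^ 2) : ℝ) : ℂ),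
        ⟨(e - f) / 2 * (2 * b * a), (e + f) / 2 * (2 * S * C)⟩;
        ⟨(e - f) / 2 * (2 * b * a), -((e + f) / 2 * (2 * S * C))⟩,
        (((e + f) / 2 * (C ^ 2 + S ^ 2) - (e - f) / 2 * (a ^ 2 - b ^ 2) : ℝ) : ℂ)] := by
  have ha : a ^ 2 = 1 - b ^ 2 := by linarith
  have hC : C ^ 2 = 1 + S ^ 2 := by linarith
  ext i j
  fin_cases i <;> fin_cases j <;> apply Complex.ext <;>
    simp [rotationBoost, mul_apply, Fin.sum_univ_two, -Complex.ofReal_add, -Complex.ofReal_mul,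
      -Complex.ofReal_sub, -Complex.ofReal_div, -Complex.ofReal_pow] <;> grind

/-- A positive Hermitian matrix of determinant one is congruent, under the complex rotation
group, to a diagonal one. -/
theorem exists_memSO2C_conjTranspose_mul_expDiag_mul {p q x y : ℝ} (hpq : 0 ≤ p + q)
    (hdet : p * q - x ^ 2 - y ^ 2 = 1) :
    ∃ (t : ℝ) (h : Matrix (Fin 2) (Fin 2) ℂ), 0 ≤ t ∧ MemSO2C h ∧
      hᴴ * expDiag (2 * t) * h = !![(p : ℂ), ⟨x, y⟩; ⟨x, -y⟩, (q : ℂ)] := by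
  obtain ⟨t, η, θ, ht, hsum, hy, hdiff, hx⟩ := exists_hyperboloid_coordinates hpq hdet
  have hab := Real.cos_sq_add_sin_sq θ
  have hCS := Real.cosh_sq_sub_sinh_sq η
  refine ⟨t, rotationBoost (Real.cos θ) (Real.sin θ) (Real.cosh η) (Real.sinh η), ht,
    memSO2C_rotationBoost hab hCS, ?_⟩
  rw [expDiag, conjTranspose_rotationBoost_mul_diagonal_mul _ _ hab hCS,
    ← Real.cosh_eq, ← Real.sinh_eq, ← Real.cosh_two_mul, ← Real.cos_two_mul',
    ← Real.sin_two_mul, ← Real.sinh_two_mul, ← hsum, ← hdiff, ← hx, ← hy]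
  congr 5 <;> ring_nf

open scoped ComplexOrder in
theorem exists_eq_mul_expDiag_mul (g : Matrix (Fin 2) (Fin 2) ℂ) (hg : g.det = 1) :
    ∃ (k : Matrix (Fin 2) (Fin 2) ℂ) (t : ℝ) (h : Matrix (Fin 2) (Fin 2) ℂ),
      MemSU2 k ∧ 0 ≤ t ∧ MemSO2C h ∧ g = k * expDiag t * h := by
  have hp := (isHermitian_conjTranspose_mul_self g).apply 0 0
  have hq := (isHermitian_conjTranspose_mul_self g).apply 1 1
  have hz := (isHermitian_conjTranspose_mul_self g).apply 1 0
  have hdet : (gᴴ * g).det = 1 := by simp [det_conjTranspose, hg]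
  have htr := (posSemidef_conjTranspose_mul_self g).trace_nonneg
  rw [det_fin_two, ← hz] at hdet
  rw [trace_fin_two] at htr
  have hform : gᴴ * g = !![(((gᴴ * g) 0 0).re : ℂ), ⟨((gᴴ * g) 0 1).re, ((gᴴ * g) 0 1).im⟩;
      ⟨((gᴴ * g) 0 1).re, -((gᴴ * g) 0 1).im⟩, (((gᴴ * g) 1 1).re : ℂ)] := by
    ext i j
    fin_cases i <;> fin_cases j
    · exact (Complex.conj_eq_iff_re.1 hp).symm
    · rfl
    · exact hz.symm
    · exact (Complex.conj_eq_iff_re.1 hq).symm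
  obtain ⟨t, h, ht, hh, heq⟩ := exists_memSO2C_conjTranspose_mul_expDiag_mul
    (p := ((gᴴ * g) 0 0).re) (q := ((gᴴ * g) 1 1).re)
    (x := ((gᴴ * g) 0 1).re) (y := ((gᴴ * g) 0 1).im)
    (by simpa using (Complex.le_def.1 htr).1)
    (by
      have := congrArg Complex.re hdet
      rw [← Complex.conj_eq_iff_re.1 hp, ← Complex.conj_eq_iff_re.1 hq] at this
      simp only [Complex.sub_re, Complex.mul_re, Complex.ofReal_re, Complex.ofReal_im,
        Complex.star_def, Complex.conj_re, Complex.conj_im, Complex.one_re] at this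
      linarith)
  rw [← hform] at heq
  have hh' : h * hᵀ = 1 := mul_eq_one_comm.1 hh.1
  refine ⟨g * hᵀ * expDiag (-t), t, h, ⟨?_, ?_⟩, ht, hh, ?_⟩
  · have hstar : hᵀᴴ * hᴴ = 1 := by rw [← conjTranspose_mul, hh', conjTranspose_one]
    calc (g * hᵀ * expDiag (-t))ᴴ * (g * hᵀ * expDiag (-t))
        = expDiag (-t) * hᵀᴴ * (gᴴ * g) * hᵀ * expDiag (-t) := by
          simp only [conjTranspose_mul, conjTranspose_expDiag, Matrix.mul_assoc]
      _ = expDiag (-t) * (hᵀᴴ * hᴴ) * expDiag (2 * t) * (h * hᵀ) * expDiag (-t) := by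
          rw [← heq]; simp only [Matrix.mul_assoc]
      _ = 1 := by
          rw [hstar, hh', Matrix.mul_one, Matrix.mul_one, expDiag_mul, expDiag_mul,
            ← expDiag_zero]
          congr 1
          ring
  · rw [det_mul, det_mul, det_transpose, hg, hh.2, det_expDiag, mul_one, mul_one]
  · rw [Matrix.mul_assoc _ (expDiag (-t)), expDiag_mul, neg_add_cancel, expDiag_zero,
      Matrix.mul_one, Matrix.mul_assoc, hh.1, Matrix.mul_one]

theorem trace_conjTranspose_mul_self_mul_transpose {k h : Matrix (Fin 2) (Fin 2) ℂ} (t : ℝ)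
    (hk : MemSU2 k) (hh : MemSO2C h) {g : Matrix (Fin 2) (Fin 2) ℂ} (hg : g = k * expDiag t * h) :
    (gᴴ * g * (gᴴ * g)ᵀ).trace = ((2 * Real.cosh (4 * t) : ℝ) : ℂ) := by
  have hh' : h * hᵀ = 1 := mul_eq_one_comm.1 hh.1
  have hstar : hᴴᵀ * hᴴ = 1 := by
    change hᵀᴴ * hᴴ = 1
    rw [← conjTranspose_mul, hh', conjTranspose_one]
  have hgg : gᴴ * g = hᴴ * expDiag (2 * t) * h := by
    calc gᴴ * g = hᴴ * expDiag t * (kᴴ * k) * expDiag t * h := by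
          simp only [hg, conjTranspose_mul, conjTranspose_expDiag, Matrix.mul_assoc]
      _ = hᴴ * expDiag (2 * t) * h := by
          rw [hk.1, Matrix.mul_one, Matrix.mul_assoc hᴴ, expDiag_mul, two_mul]
  calc (gᴴ * g * (gᴴ * g)ᵀ).trace
      = (hᴴ * (expDiag (2 * t) * (h * hᵀ) * expDiag (2 * t) * hᴴᵀ)).trace := by
        rw [hgg]
        simp only [transpose_mul, transpose_expDiag, Matrix.mul_assoc]
    _ = (expDiag (4 * t)).trace := by
        rw [trace_mul_comm, hh', Matrix.mul_one, Matrix.mul_assoc _ hᴴᵀ, hstar, Matrix.mul_one,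
          expDiag_mul]
        congr 2
        ring
    _ = _ := trace_expDiag _

/-- Proposition 2.7: the decomposition
`SL(2,ℂ) = SU(2) · exp(a⁺) · SO(2,ℂ)`, with the middle parameter `t ≥ 0`
uniquely determined. -/
theorem stmt7 (g : Matrix (Fin 2) (Fin 2) ℂ) (hg : g.det = 1) :
    (∃ (k : Matrix (Fin 2) (Fin 2) ℂ) (t : ℝ) (h : Matrix (Fin 2) (Fin 2) ℂ),
      MemSU2 k ∧ 0 ≤ t ∧ MemSO2C h ∧
      g = k * !![(Real.exp t : ℂ), 0; 0, (Real.exp (-t) : ℂ)] * h) ∧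
    ∀ (k k' : Matrix (Fin 2) (Fin 2) ℂ) (t t' : ℝ)
        (h h' : Matrix (Fin 2) (Fin 2) ℂ),
      MemSU2 k → 0 ≤ t → MemSO2C h →
      g = k * !![(Real.exp t : ℂ), 0; 0, (Real.exp (-t) : ℂ)] * h →
      MemSU2 k' → 0 ≤ t' → MemSO2C h' →
      g = k' * !![(Real.exp t' : ℂ), 0; 0, (Real.exp (-t') : ℂ)] * h' →
      t = t' := by
  refine ⟨exists_eq_mul_expDiag_mul g hg, ?_⟩
  intro k k' t t' h h' hk ht hh hkh hk' ht' hh' hkh'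
  have htrace := (trace_conjTranspose_mul_self_mul_transpose t hk hh hkh).symm.trans
    (trace_conjTranspose_mul_self_mul_transpose t' hk' hh' hkh')
  have hcosh : Real.cosh (4 * t) = Real.cosh (4 * t') :=
    mul_left_cancel₀ two_ne_zero (Complex.ofReal_injective htrace)
  have : 4 * t = 4 * t' := Real.cosh_strictMonoOn.injOn (Set.mem_Ici.2 (by positivity))
    (Set.mem_Ici.2 (by positivity)) hcosh
  linarith
end

section
/- Let $n$ be an odd positive integer and $l$ an even integer with $0\le l<n$. Define $c(\lambda)=2^{\,n+l-\lambda}\dfrac{\Gamma(n)\,\Gamma(\lambda)}{\Gamma\big(\frac{\lambda+n+l}{2}\big)\Gamma\big(\frac{\lambda+n-l}{2}\big)}$ using the complex Gamma function. Then for every $\lambda\in\mathbb{C}\setminus\mathbb{Z}$: $\dfrac{1}{c(\lambda)c(-\lambda)}\;=\;-\pi\,2^{-(4n+2l-3)}\,\Gamma(n)^{-2}\;\lambda\,\prod_{j=1}^{(n-l-1)/2}\big(\lambda^{2}-(n-l-2j)^{2}\big)\,\prod_{j=1}^{(n+l-1)/2}\big(\lambda^{2}-(n+l-2j)^{2}\big)\;\tan\Big(\frac{\pi\lambda}{2}\Big).$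 -/
open Finset

theorem prod_odd_sq_reflect (k : ℕ) (z : ℂ) :
    ∏ j ∈ Finset.Icc 1 k, (z ^ 2 - (2 * (k : ℂ) + 1 - 2 * (j : ℂ)) ^ 2) =
      ∏ i ∈ Finset.range k, (z ^ 2 - (2 * (i : ℂ) + 1) ^ 2) := by
  refine Finset.prod_nbij' (fun j => k - j) (fun i => k - i) ?_ ?_ ?_ ?_ ?_
  · intro j hj; simp only [Finset.mem_Icc, Finset.mem_range] at *; omega
  · intro j hj; simp only [Finset.mem_Icc, Finset.mem_range] at *; omega
  · intro j hj; simp only [Finset.mem_Icc] at *; omega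
  · intro j hj; simp only [Finset.mem_range] at *; omega
  · intro j hj
    rw [Nat.cast_sub (Finset.mem_Icc.mp hj).2]
    ring

/-- The reflection formula at `1/2 + z/2`, shifted by `k` in both arguments. -/
theorem Gamma_half_add_mul_Gamma_half_sub (k : ℕ) (z : ℂ) (hz : ∀ m : ℤ, z ≠ (m : ℂ)) :
    Complex.Gamma ((z + (2 * (k : ℂ) + 1)) / 2) * Complex.Gamma ((-z + (2 * (k : ℂ) + 1)) / 2) =
      Real.pi / Complex.cos (Real.pi * z / 2) * (-1 / 4) ^ k *
        ∏ i ∈ Finset.range k, (z ^ 2 - (2 * (i : ℂ) + 1) ^ 2) := by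
  induction k with
  | zero =>
    have h := Complex.Gamma_mul_Gamma_one_sub ((z + 1) / 2)
    rw [show (Real.pi : ℂ) * ((z + 1) / 2) = Real.pi * z / 2 + Real.pi / 2 by ring,
      Complex.sin_add_pi_div_two, show 1 - (z + 1) / 2 = (-z + 1) / 2 by ring] at h
    simpa using h
  | succ k ih =>
    have h₁ : (z + (2 * (k : ℂ) + 1)) / 2 ≠ 0 := fun h =>
      hz (-(2 * k + 1)) (by push_cast; linear_combination 2 * h)
    have h₂ : (-z + (2 * (k : ℂ) + 1)) / 2 ≠ 0 := fun h =>
      hz (2 * k + 1) (by push_cast; linear_combination -2 * h)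
    rw [Finset.prod_range_succ, pow_succ,
      show (z + (2 * ((k + 1 : ℕ) : ℂ) + 1)) / 2 = (z + (2 * (k : ℂ) + 1)) / 2 + 1 by
        push_cast; ring,
      show (-z + (2 * ((k + 1 : ℕ) : ℂ) + 1)) / 2 = (-z + (2 * (k : ℂ) + 1)) / 2 + 1 by
        push_cast; ring,
      Complex.Gamma_add_one _ h₁, Complex.Gamma_add_one _ h₂]
    linear_combination ((z + (2 * (k : ℂ) + 1)) / 2) * ((-z + (2 * (k : ℂ) + 1)) / 2) * ih

theorem Gamma_mul_Gamma_neg (z : ℂ) (hz : z ≠ 0) :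
    Complex.Gamma z * Complex.Gamma (-z) = -(Real.pi / (z * Complex.sin (Real.pi * z))) := by
  have h := Complex.Gamma_mul_Gamma_one_sub z
  rw [show 1 - z = -z + 1 by ring, Complex.Gamma_add_one _ (neg_ne_zero.mpr hz)] at h
  rw [mul_comm z, ← div_div, ← h]
  field_simp

/-- The case (`n` odd, `l` even) of identity (3.12) for the Harish-Chandra
`c`-function of the multiplicity `m₊(l)` on `SU(1,n)`:
`[c(λ)c(-λ)]⁻¹ = γ_{n,l} p_{n,l}(λ) tan(πλ/2)`. -/
theorem stmt17 (n l : ℕ) (hn : Odd n) (hl : Even l) (hln : l < n)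
    (c : ℂ → ℂ)
    (hc : ∀ z : ℂ, c z = (2 : ℂ) ^ ((n : ℂ) + (l : ℂ) - z) *
      (Complex.Gamma (n : ℂ) * Complex.Gamma z /
        (Complex.Gamma ((z + (n : ℂ) + (l : ℂ)) / 2) *
          Complex.Gamma ((z + (n : ℂ) - (l : ℂ)) / 2)))) :
    ∀ z : ℂ, (∀ k : ℤ, z ≠ (k : ℂ)) →
      1 / (c z * c (-z)) =
        -(Real.pi : ℂ) * (2 : ℂ) ^ (-(4 * (n : ℤ) + 2 * (l : ℤ) - 3)) *
          (Complex.Gamma (n : ℂ))⁻¹ ^ 2 * z *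
          (∏ j ∈ Finset.Icc 1 ((n - l - 1) / 2),
            (z ^ 2 - ((n : ℂ) - (l : ℂ) - 2 * (j : ℂ)) ^ 2)) *
          (∏ j ∈ Finset.Icc 1 ((n + l - 1) / 2),
            (z ^ 2 - ((n : ℂ) + (l : ℂ) - 2 * (j : ℂ)) ^ 2)) *
          Complex.tan ((Real.pi : ℂ) * z / 2) := by
  intro z hz
  obtain ⟨a, ha⟩ : ∃ a, n - l = 2 * a + 1 := ((Nat.odd_sub hln.le).mpr (by simp [hn, hl]))
  obtain ⟨b, hb⟩ : ∃ b, n + l = 2 * b + 1 := hn.add_even hl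
  have hab : n = a + b + 1 := by omega
  have hla : (n : ℂ) - l = 2 * a + 1 := by
    rw [← Nat.cast_sub hln.le, ha]; push_cast; ring
  have hlb : (n : ℂ) + l = 2 * b + 1 := by exact_mod_cast hb
  have heven : Even (a + b) := by
    rw [hab] at hn; exact (Nat.odd_add_one.mp hn |> Nat.not_odd_iff_even.mp)
  have hz0 : z ≠ 0 := by simpa using hz 0
  have hpi : (Real.pi : ℂ) ≠ 0 := Complex.ofReal_ne_zero.mpr Real.pi_ne_zero
  have hsin : Complex.sin (Real.pi * z) ≠ 0 := by
    rw [Complex.sin_ne_zero_iff]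
    intro k hk
    exact hz k (mul_left_cancel₀ hpi (by linear_combination hk))
  have hdouble : Complex.sin (Real.pi * z) =
      2 * Complex.sin (Real.pi * z / 2) * Complex.cos (Real.pi * z / 2) := by
    rw [← Complex.sin_two_mul]; ring_nf
  have hcos : Complex.cos (Real.pi * z / 2) ≠ 0 := fun h => hsin (by rw [hdouble, h, mul_zero])
  have hpow : (2 : ℂ) ^ ((n : ℂ) + l - z) * (2 : ℂ) ^ ((n : ℂ) + l - -z) = 2 ^ (2 * (n + l)) := by
    rw [← Complex.cpow_add _ _ two_ne_zero, ← Complex.cpow_natCast]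
    congr 1; push_cast; ring
  have hquarter : (-1 / 4 : ℂ) ^ a * (-1 / 4) ^ b = (2 ^ (2 * (n - 1)))⁻¹ := by
    rw [← pow_add, show (-1 / 4 : ℂ) = -(1 / 4) by ring, heven.neg_pow,
      show n - 1 = a + b by omega, pow_mul, one_div, inv_pow]
    norm_num
  have htwo : (2 : ℂ) ^ (-(4 * (n : ℤ) + 2 * (l : ℤ) - 3)) =
      2 * (2 ^ (2 * (n + l)))⁻¹ * (2 ^ (2 * (n - 1)))⁻¹ := by
    rw [← zpow_natCast, ← zpow_natCast, ← zpow_neg, ← zpow_neg, ← zpow_one_add₀ two_ne_zero,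
      ← zpow_add₀ two_ne_zero]
    congr 1
    rw [show n - 1 = a + b by omega]
    push_cast
    omega
  have hA := Gamma_half_add_mul_Gamma_half_sub a z hz
  have hB := Gamma_half_add_mul_Gamma_half_sub b z hz
  have hcc : 1 / (c z * c (-z)) =
      (Complex.Gamma ((z + (2 * (a : ℂ) + 1)) / 2) *
        Complex.Gamma ((-z + (2 * (a : ℂ) + 1)) / 2)) *
      (Complex.Gamma ((z + (2 * (b : ℂ) + 1)) / 2) *
        Complex.Gamma ((-z + (2 * (b : ℂ) + 1)) / 2)) *
      (((2 : ℂ) ^ ((n : ℂ) + l - z) * (2 : ℂ) ^ ((n : ℂ) + l - -z)) * Complex.Gamma n ^ 2 *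
        (Complex.Gamma z * Complex.Gamma (-z)))⁻¹ := by
    rw [hc, hc, add_assoc z, add_assoc (-z), add_sub_assoc z, add_sub_assoc (-z), hla, hlb]
    simp only [div_eq_mul_inv, mul_inv, inv_inv]
    ring
  rw [hcc, hA, hB, hpow, Gamma_mul_Gamma_neg z hz0, hdouble, htwo, Complex.tan,
    show (n - l - 1) / 2 = a by omega, show (n + l - 1) / 2 = b by omega, hla, hlb,
    prod_odd_sq_reflect, prod_odd_sq_reflect]
  rw [← hquarter]
  generalize (-1 / 4 : ℂ) ^ a = p
  generalize (-1 / 4 : ℂ) ^ b = q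
  field_simp
end
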